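/- Under the standing assumptions (Θ nonempty convex with K < ∞, C closed convex containing 0, C∩C^0 compact), the function g(y) := inf_{θ∈Θ} g^θ(y) is concave (in the extended sense) and upper semicontinuous on C^0, with values in [−∞,∞), and both g and every individual g^θ (θ∈Θ) attain their maximum over the set C∩C^0. -/

import Mathlib

open MeasureTheory Filter Set
open scoped ENNReal NNReal Topology

noncomputable section

/-- The positive part of an extended real number, as an element of `ℝ≥0∞`. -/
def EReal.posPart (x : EReal) : ℝ≥0∞ := if x = ⊤ then ⊤ else ENNReal.ofReal x.toReal

/-- Integral of an `EReal`-valued function, defined as the difference of the lintegrals of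
the positive and negative parts, with the conventions of `EReal` arithmetic
(in particular `∞ - ∞ = -∞`). -/
def eIntegral {α : Type*} [MeasurableSpace α] (F : Measure α) (f : α → EReal) : EReal :=
  ((∫⁻ z, (f z).posPart ∂F : ℝ≥0∞) : EReal) - ((∫⁻ z, (-(f z)).posPart ∂F : ℝ≥0∞) : EReal)

/-- The dot product `y^⊤ z` on `ℝ^d`. -/
def dotp {d : ℕ} (y z : EuclideanSpace ℝ (Fin d)) : ℝ := ∑ i, y i * z i

/-- The quadratic form `y^⊤ c y`. -/
def quadf {d : ℕ} (c : Matrix (Fin d) (Fin d) ℝ) (y : EuclideanSpace ℝ (Fin d)) : ℝ :=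
  ∑ i, ∑ j, c i j * y i * y j

/-- The (Frobenius) norm `|c|` of a matrix. -/
def matNorm {d : ℕ} (c : Matrix (Fin d) (Fin d) ℝ) : ℝ :=
  Real.sqrt (∑ i, ∑ j, (c i j) ^ 2)

/-- A Lévy measure on `ℝ^d`: a (Borel) measure with `F({0}) = 0` and `∫ |z|² ∧ 1 F(dz) < ∞`. -/
def IsLevyMeasure {d : ℕ} (F : Measure (EuclideanSpace ℝ (Fin d))) : Prop :=
  F {0} = 0 ∧ ∫⁻ z, ENNReal.ofReal (min (‖z‖ ^ 2) 1) ∂F < ⊤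

/-- A truncation function: bounded, measurable, equal to the identity near the origin. -/
structure IsTruncation {d : ℕ}
    (h : EuclideanSpace ℝ (Fin d) → EuclideanSpace ℝ (Fin d)) : Prop where
  measurable : Measurable h
  bounded : ∃ M : ℝ, ∀ z, ‖h z‖ ≤ M
  eq_id_near_zero : ∃ δ : ℝ, 0 < δ ∧ ∀ z, ‖z‖ < δ → h z = z

/-- The integrand `I_y(z)`, as an extended real number:
`log(1+y^⊤z) - y^⊤h(z)` if `p = 0`, and `p⁻¹(1+y^⊤z)^p - p⁻¹ - y^⊤h(z)` if `p ≠ 0`,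
with the conventions `log 0 = -∞` and `0^p = +∞` for `p < 0` (so that the integrand
is `-∞` on `{1 + y^⊤z ≤ 0}` when `p ≤ 0`). -/
def Ifun {d : ℕ} (p : ℝ) (h : EuclideanSpace ℝ (Fin d) → EuclideanSpace ℝ (Fin d))
    (y z : EuclideanSpace ℝ (Fin d)) : EReal :=
  if 0 < 1 + dotp y z then
    (if p = 0 then ((Real.log (1 + dotp y z) - dotp y (h z) : ℝ) : EReal)
      else ((p⁻¹ * (1 + dotp y z) ^ p - p⁻¹ - dotp y (h z) : ℝ) : EReal))
  else if p ≤ 0 then (⊥ : EReal)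
  else ((p⁻¹ * (1 + dotp y z) ^ p - p⁻¹ - dotp y (h z) : ℝ) : EReal)

/-- The function `g^{(b,c,F)}(y) = y^⊤b + ((p-1)/2)·y^⊤cy + ∫ I_y(z) F(dz)`. -/
def gfun {d : ℕ} (p : ℝ) (h : EuclideanSpace ℝ (Fin d) → EuclideanSpace ℝ (Fin d))
    (b : EuclideanSpace ℝ (Fin d)) (c : Matrix (Fin d) (Fin d) ℝ)
    (F : Measure (EuclideanSpace ℝ (Fin d))) (y : EuclideanSpace ℝ (Fin d)) : EReal :=
  ((dotp y b + (p - 1) / 2 * quadf c y : ℝ) : EReal) + eIntegral F (fun z => Ifun p h y z)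

/-- Triples `θ = (b, c, F)`. -/
abbrev Triple (d : ℕ) :=
  EuclideanSpace ℝ (Fin d) × Matrix (Fin d) (Fin d) ℝ × Measure (EuclideanSpace ℝ (Fin d))

/-- `g^θ(y)` for a triple `θ = (b,c,F)`. -/
def gTheta {d : ℕ} (p : ℝ) (h : EuclideanSpace ℝ (Fin d) → EuclideanSpace ℝ (Fin d))
    (θ : Triple d) (y : EuclideanSpace ℝ (Fin d)) : EReal :=
  gfun p h θ.1 θ.2.1 θ.2.2 y

/-- The integrand appearing in the definition of the constant `K`, depending on `p`
(and an extra parameter `ε > 0` when `p ∈ (0,1)`). -/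
def Kintegrand {d : ℕ} (p ε : ℝ) (z : EuclideanSpace ℝ (Fin d)) : ℝ :=
  if p = 0 then min (‖z‖ ^ 2) (Real.log (1 + ‖z‖))
  else if 0 < p then min (‖z‖ ^ 2) (‖z‖ ^ (p * (1 + ε)))
  else min (‖z‖ ^ 2) 1

/-- The natural constraints `C⁰ = ∩_{F ∈ L_Θ} {y : F({z : y^⊤z < -1}) = 0}`. -/
def natC {d : ℕ} (Θ : Set (Triple d)) : Set (EuclideanSpace ℝ (Fin d)) :=
  {y | ∀ θ ∈ Θ, θ.2.2 {z | dotp y z < -1} = 0}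

/-- The sets `C⁰ₙ = ∩_{F ∈ L_Θ} {y : F({z : y^⊤z < -1 + 1/n}) = 0}`. -/
def natCn {d : ℕ} (Θ : Set (Triple d)) (n : ℕ) : Set (EuclideanSpace ℝ (Fin d)) :=
  {y | ∀ θ ∈ Θ, θ.2.2 {z | dotp y z < -1 + 1 / (n : ℝ)} = 0}

/-- The finite measure `|z|² ∧ 1 · F`. -/
def sq1Measure {d : ℕ} (F : Measure (EuclideanSpace ℝ (Fin d))) :
    Measure (EuclideanSpace ℝ (Fin d)) :=
  F.withDensity (fun z => ENNReal.ofReal (min (‖z‖ ^ 2) 1))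

/-- The standing assumptions of the paper: `p = 0` or `p ∈ (-∞,0) ∪ (0,1)`, `ε > 0`,
`h` is a truncation function, `Θ` is a nonempty convex set of Lévy triplets with `K < ∞`,
`C` is closed, convex and contains `0`, and `C ∩ C⁰` is compact. -/
structure Standing {d : ℕ} (p ε : ℝ)
    (h : EuclideanSpace ℝ (Fin d) → EuclideanSpace ℝ (Fin d))
    (Θ : Set (Triple d)) (C : Set (EuclideanSpace ℝ (Fin d))) : Prop where
  p_range : p = 0 ∨ p < 0 ∨ (0 < p ∧ p < 1)
  eps_pos : 0 < ε
  trunc : IsTruncation h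
  Theta_nonempty : Θ.Nonempty
  Theta_psd : ∀ θ ∈ Θ, (θ.2.1).PosSemidef
  Theta_levy : ∀ θ ∈ Θ, IsLevyMeasure θ.2.2
  Theta_convex : ∀ θ₁ ∈ Θ, ∀ θ₂ ∈ Θ, ∀ t : ℝ, 0 ≤ t → t ≤ 1 →
    (t • θ₁.1 + (1 - t) • θ₂.1, t • θ₁.2.1 + (1 - t) • θ₂.2.1,
      ENNReal.ofReal t • θ₁.2.2 + ENNReal.ofReal (1 - t) • θ₂.2.2) ∈ Θ
  K_finite : ∃ K : ℝ, ∀ θ ∈ Θ,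
    (∫⁻ z, ENNReal.ofReal (Kintegrand p ε z) ∂θ.2.2) ≠ ⊤ ∧
    ‖θ.1‖ + matNorm θ.2.1 + (∫⁻ z, ENNReal.ofReal (Kintegrand p ε z) ∂θ.2.2).toReal ≤ K
  C_closed : IsClosed C
  C_convex : Convex ℝ C
  C_zero : (0 : EuclideanSpace ℝ (Fin d)) ∈ C
  CC0_compact : IsCompact (C ∩ natC Θ)

/-- The real utility function: `log x` for `p = 0` and `(x ^ p - 1) / p` for `p ≠ 0`. -/
def phi (p x : ℝ) : ℝ := if p = 0 then Real.log x else p⁻¹ * x ^ p - p⁻¹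

lemma phi_le_log_of_neg {p x : ℝ} (hp : p < 0) (hx : 0 < x) : phi p x ≤ Real.log x := by
  have h1 : Real.log x * p + 1 ≤ x ^ p := by
    rw [Real.rpow_def_of_pos hx]
    exact Real.add_one_le_exp _
  have h2 : p⁻¹ * x ^ p ≤ p⁻¹ * (Real.log x * p + 1) :=
    mul_le_mul_of_nonpos_left h1 (inv_lt_zero.mpr hp).le
  have h3 : p⁻¹ * (Real.log x * p + 1) = Real.log x + p⁻¹ := by
    have := inv_mul_cancel₀ hp.ne
    linear_combination Real.log x * this
  rw [phi, if_neg hp.ne]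
  linarith

lemma phi_le_sub_one {p x : ℝ} (hp : p < 1) (hx : 0 ≤ x) (hxp : 0 < x ∨ 0 < p) :
    phi p x ≤ x - 1 := by
  rcases lt_trichotomy p 0 with h | h | h
  · have hx' : 0 < x := hxp.resolve_right h.not_gt
    exact (phi_le_log_of_neg h hx').trans (Real.log_le_sub_one_of_pos hx')
  · have hx' : 0 < x := hxp.resolve_right h.not_gt
    rw [phi, if_pos h]
    exact Real.log_le_sub_one_of_pos hx'
  · rw [phi, if_neg h.ne']
    have h1 := rpow_one_add_le_one_add_mul_self (s := x - 1) (by linarith) h.le hp.le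
    rw [add_sub_cancel] at h1
    have h2 : p⁻¹ * x ^ p ≤ p⁻¹ * (1 + p * (x - 1)) :=
      mul_le_mul_of_nonneg_left h1 (inv_pos.mpr h).le
    have h3 : p⁻¹ * (1 + p * (x - 1)) = p⁻¹ + (x - 1) := by
      field_simp
    linarith

lemma phi_mono {p x y : ℝ} (hx : 0 ≤ x) (hxp : 0 < x ∨ 0 < p) (hxy : x ≤ y) :
    phi p x ≤ phi p y := by
  unfold phi
  rcases lt_trichotomy p 0 with h | h | h
  · have hx' : 0 < x := hxp.resolve_right h.not_gt
    rw [if_neg h.ne, if_neg h.ne]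
    have h1 := mul_le_mul_of_nonpos_left (Real.rpow_le_rpow_of_nonpos hx' hxy h.le)
      (inv_lt_zero.mpr h).le
    linarith
  · have hx' : 0 < x := hxp.resolve_right h.not_gt
    rw [if_pos h, if_pos h]
    exact Real.log_le_log hx' hxy
  · rw [if_neg h.ne', if_neg h.ne']
    have h1 := mul_le_mul_of_nonneg_left (Real.rpow_le_rpow hx hxy h.le) (inv_pos.mpr h).le
    linarith

lemma phi_concave {p x y s t : ℝ} (hp : p < 1) (hx : 0 ≤ x) (hxp : 0 < x ∨ 0 < p)
    (hy : 0 ≤ y) (hyp : 0 < y ∨ 0 < p) (hs : 0 ≤ s) (ht : 0 ≤ t) (hst : s + t = 1) :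
    s * phi p x + t * phi p y ≤ phi p (s * x + t * y) := by
  unfold phi
  rcases lt_trichotomy p 0 with h | h | h
  · have hx' : 0 < x := hxp.resolve_right h.not_gt
    have hy' : 0 < y := hyp.resolve_right h.not_gt
    have hxy : 0 < s * x + t * y := by
      simpa using convex_Ioi (0 : ℝ) hx' hy' hs ht hst
    simp only [if_neg h.ne]
    have h1 : (s * x + t * y) ^ p ≤ s * x ^ p + t * y ^ p := by
      rw [Real.rpow_def_of_pos hx', Real.rpow_def_of_pos hy', Real.rpow_def_of_pos hxy]
      have h2 := strictConcaveOn_log_Ioi.concaveOn.2 hx' hy' hs ht hst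
      have h3 := convexOn_exp.2 (mem_univ (Real.log x * p)) (mem_univ (Real.log y * p)) hs ht hst
      simp only [smul_eq_mul] at h2 h3
      refine le_trans (Real.exp_le_exp.mpr ?_) h3
      nlinarith
    have h4 := mul_le_mul_of_nonpos_left h1 (inv_lt_zero.mpr h).le
    obtain rfl : t = 1 - s := by linarith
    linarith
  · have hx' : 0 < x := hxp.resolve_right h.not_gt
    have hy' : 0 < y := hyp.resolve_right h.not_gt
    simp only [if_pos h]
    exact strictConcaveOn_log_Ioi.concaveOn.2 hx' hy' hs ht hst
  · simp only [if_neg h.ne']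
    have h1 := (Real.concaveOn_rpow h.le hp.le).2 hx hy hs ht hst
    simp only [smul_eq_mul] at h1
    have h4 := mul_le_mul_of_nonneg_left h1 (inv_pos.mpr h).le
    obtain rfl : t = 1 - s := by linarith
    linarith

/-- The utility function extended by `⊥` on `x ≤ 0` when `p ≤ 0`. -/
def psi (p x : ℝ) : EReal := if 0 < x ∨ 0 < p then (phi p x : EReal) else ⊥

lemma measurable_psi (p : ℝ) : Measurable (psi p) := by
  have h1 : Measurable (phi p) := by
    unfold phi
    by_cases h : p = 0
    · simpa [h] using Real.measurable_log
    · simp only [if_neg h]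
      fun_prop
  unfold psi
  refine Measurable.ite ?_ h1.coe_real_ereal measurable_const
  by_cases h : 0 < p
  · simp [h]
  · simp only [h, or_false]
    exact measurableSet_Ioi

lemma tendsto_phi_zero {p : ℝ} (hp : p ≤ 0) : Tendsto (phi p) (𝓝[>] 0) atBot := by
  have hlog := Real.tendsto_log_nhdsGT_zero
  rcases hp.lt_or_eq with h | h
  · refine tendsto_atBot_mono' _ ?_ hlog
    filter_upwards [self_mem_nhdsWithin] with x hx using phi_le_log_of_neg h hx
  · have : phi p = Real.log := by
      ext x
      simp [phi, h]
    rwa [this]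

lemma continuousOn_psi (p : ℝ) : ContinuousOn (psi p) (Ici 0) := by
  intro x hx
  by_cases hxp : 0 < x ∨ 0 < p
  · have hphi : ContinuousAt (phi p) x := by
      unfold phi
      by_cases h : p = 0
      · have hx' : x ≠ 0 := (hxp.resolve_right (by simp [h])).ne'
        simpa [h] using Real.continuousAt_log hx'
      · simp only [if_neg h]
        have hc : ContinuousAt (fun x : ℝ => x ^ p) x :=
          Real.continuousAt_rpow_const _ _ (hxp.imp (fun h => h.ne') (fun h => h.le))
        exact (hc.const_mul _).sub continuousAt_const
    have hev : psi p =ᶠ[𝓝 x] fun x => (phi p x : EReal) := by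
      rcases hxp with h | h
      · filter_upwards [lt_mem_nhds h] with w hw
        simp [psi, hw]
      · exact Eventually.of_forall fun w => by simp [psi, h]
    exact ((continuous_coe_real_ereal.continuousAt.comp hphi).congr hev.symm).continuousWithinAt
  · rw [not_or, not_lt, not_lt] at hxp
    obtain rfl : x = 0 := le_antisymm hxp.1 hx
    have h0 : psi p 0 = ⊥ := by simp [psi, hxp.2]
    rw [ContinuousWithinAt, h0, EReal.tendsto_nhds_bot_iff_real]
    intro a
    have h1 := (tendsto_phi_zero hxp.2).eventually (eventually_lt_atBot a)
    rw [eventually_nhdsWithin_iff] at h1 ⊢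
    filter_upwards [h1] with w hw _
    by_cases hw0 : 0 < w
    · simpa [psi, hw0] using hw hw0
    · simp [psi, hw0, hxp.2.not_gt, EReal.bot_lt_coe]

lemma exists_phi_tail_bound {p ε δ R B : ℝ} (hp : p = 0 ∨ p < 0 ∨ (0 < p ∧ p < 1)) (hε : 0 < ε)
    (hδ : 0 < δ) (hR : 0 ≤ R) (hB : 0 ≤ B) :
    ∃ A : ℝ, 0 ≤ A ∧ ∀ {d : ℕ} (z : EuclideanSpace ℝ (Fin d)), δ ≤ ‖z‖ →
      phi p (1 + R * ‖z‖) + B ≤ A * Kintegrand p ε z := by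
  rcases hp with h | h | ⟨h, h'⟩
  · have hl : 0 < Real.log (1 + δ) := Real.log_pos (by linarith)
    have hlR : 0 ≤ Real.log (1 + R) := Real.log_nonneg (by linarith)
    have hm : 0 < min δ 1 := lt_min hδ one_pos
    refine ⟨((Real.log (1 + R) + B) / Real.log (1 + δ) + 1) / min δ 1, by positivity, ?_⟩
    intro d z hz
    simp only [phi, Kintegrand, if_pos h]
    generalize ‖z‖ = r at hz
    have hr : 0 < r := hδ.trans_le hz
    have h1 : Real.log (1 + R * r) ≤ Real.log (1 + R) + Real.log (1 + r) := by
      rw [← Real.log_mul (by positivity) (by positivity)]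
      exact Real.log_le_log (by positivity) (by nlinarith)
    have h2 : Real.log (1 + δ) ≤ Real.log (1 + r) := Real.log_le_log (by positivity) (by linarith)
    have h3 : Real.log (1 + r) ≤ r := by
      have := Real.log_le_sub_one_of_pos (x := 1 + r) (by positivity)
      linarith
    have h4 : min δ 1 * Real.log (1 + r) ≤ min (r ^ 2) (Real.log (1 + r)) := by
      refine le_min ?_ ?_
      · nlinarith [min_le_left δ 1]
      · nlinarith [min_le_right δ 1]
    have h5 : Real.log (1 + R) + B ≤
        (Real.log (1 + R) + B) / Real.log (1 + δ) * Real.log (1 + r) := by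
      rw [div_mul_eq_mul_div, le_div_iff₀ hl]
      exact mul_le_mul_of_nonneg_left h2 (by positivity)
    calc Real.log (1 + R * r) + B
        ≤ ((Real.log (1 + R) + B) / Real.log (1 + δ) + 1) * Real.log (1 + r) := by linarith
      _ = ((Real.log (1 + R) + B) / Real.log (1 + δ) + 1) / min δ 1 *
          (min δ 1 * Real.log (1 + r)) := by field_simp
      _ ≤ _ := mul_le_mul_of_nonneg_left h4 (by positivity)
  · have hm : 0 < min (δ ^ 2) 1 := lt_min (by positivity) one_pos
    have hpi : 0 < -p⁻¹ := by
      have := inv_lt_zero.mpr h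
      linarith
    refine ⟨(-p⁻¹ + B) / min (δ ^ 2) 1, by positivity, ?_⟩
    intro d z hz
    simp only [phi, Kintegrand, if_neg h.ne, if_neg h.not_gt]
    have hr := norm_nonneg z
    generalize ‖z‖ = r at hz hr
    have h1 : 0 ≤ (1 + R * r) ^ p := by positivity
    have h2 : min (δ ^ 2) 1 ≤ min (r ^ 2) 1 := by gcongr
    calc p⁻¹ * (1 + R * r) ^ p - p⁻¹ + B ≤ -p⁻¹ + B := by nlinarith
      _ = (-p⁻¹ + B) / min (δ ^ 2) 1 * min (δ ^ 2) 1 := by field_simp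
      _ ≤ _ := by gcongr
  · have hm : 0 < min (δ ^ (2 - p)) (δ ^ (p * ε)) := lt_min (by positivity) (by positivity)
    refine ⟨(p⁻¹ * R ^ p + B / δ ^ p) / min (δ ^ (2 - p)) (δ ^ (p * ε)), by positivity, ?_⟩
    intro d z hz
    simp only [phi, Kintegrand, if_neg h.ne', if_pos h]
    generalize ‖z‖ = r at hz
    have hr : 0 < r := hδ.trans_le hz
    have h1 : (1 + R * r) ^ p ≤ 1 + R ^ p * r ^ p := by
      rw [← Real.mul_rpow hR hr.le]
      simpa using Real.rpow_add_le_add_rpow zero_le_one (mul_nonneg hR hr.le) h.le h'.le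
    have h2 : B ≤ B / δ ^ p * r ^ p := by
      rw [div_mul_eq_mul_div, le_div_iff₀ (by positivity)]
      gcongr
    have h4 : min (δ ^ (2 - p)) (δ ^ (p * ε)) * r ^ p ≤ min (r ^ 2) (r ^ (p * (1 + ε))) := by
      refine le_min ?_ ?_
      · calc _ ≤ r ^ (2 - p) * r ^ p := by
              gcongr
              exact (min_le_left _ _).trans (Real.rpow_le_rpow hδ.le hz (by linarith))
          _ = r ^ 2 := by
              rw [← Real.rpow_add hr]
              norm_num
      · calc _ ≤ r ^ (p * ε) * r ^ p := by
              gcongr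
              exact (min_le_right _ _).trans (Real.rpow_le_rpow hδ.le hz (by positivity))
          _ = r ^ (p * (1 + ε)) := by
              rw [← Real.rpow_add hr]
              ring_nf
    have h5 := mul_le_mul_of_nonneg_left h1 (inv_pos.mpr h).le
    calc p⁻¹ * (1 + R * r) ^ p - p⁻¹ + B ≤ (p⁻¹ * R ^ p + B / δ ^ p) * r ^ p := by linarith
      _ = (p⁻¹ * R ^ p + B / δ ^ p) / min (δ ^ (2 - p)) (δ ^ (p * ε)) *
          (min (δ ^ (2 - p)) (δ ^ (p * ε)) * r ^ p) := by field_simp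
      _ ≤ _ := by gcongr

lemma eIntegral_eq_of_le {α : Type*} [MeasurableSpace α] {F : Measure α} {f : α → EReal}
    {k : α → ℝ} (hf : Measurable f) (hk : Measurable k) (hk0 : ∀ z, 0 ≤ k z)
    (hfk : ∀ᵐ z ∂F, f z ≤ k z) (hint : ∫⁻ z, ENNReal.ofReal (k z) ∂F ≠ ⊤) :
    eIntegral F f = (((∫⁻ z, ENNReal.ofReal (k z) ∂F).toReal : ℝ) : EReal) -
      ((∫⁻ z, ((k z : EReal) - f z).toENNReal ∂F : ℝ≥0∞) : EReal) := by
  have hpt : ∀ᵐ z ∂F, (f z).toENNReal + ((k z : EReal) - f z).toENNReal =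
      ENNReal.ofReal (k z) + (-(f z)).toENNReal := by
    filter_upwards [hfk] with z hz
    have hkz := hk0 z
    generalize k z = a at hz hkz
    induction h : f z with
    | bot => simp
    | top => simp [h] at hz
    | coe r =>
      rw [h, EReal.coe_le_coe_iff] at hz
      rw [← EReal.coe_sub, ← EReal.coe_neg]
      simp only [EReal.real_coe_toENNReal]
      rcases le_total 0 r with hr | hr
      · rw [← ENNReal.ofReal_add hr (by linarith), ENNReal.ofReal_of_nonpos (p := -r) (by linarith)]
        simp
      · rw [← ENNReal.ofReal_add hkz (by linarith), ENNReal.ofReal_of_nonpos (p := r) hr]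
        simp [sub_eq_add_neg]
  have hpos : ∫⁻ z, (f z).toENNReal ∂F ≤ ∫⁻ z, ENNReal.ofReal (k z) ∂F := by
    refine lintegral_mono_ae ?_
    filter_upwards [hfk] with z hz
    simpa using EReal.toENNReal_le_toENNReal hz
  have hsum := lintegral_congr_ae hpt
  rw [lintegral_add_left hf.ereal_toENNReal, lintegral_add_left hk.ennreal_ofReal] at hsum
  change ((∫⁻ z, (f z).toENNReal ∂F : ℝ≥0∞) : EReal) -
    ((∫⁻ z, (-(f z)).toENNReal ∂F : ℝ≥0∞) : EReal) = _
  generalize ∫⁻ z, (f z).toENNReal ∂F = P at *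
  generalize ∫⁻ z, (-(f z)).toENNReal ∂F = N at *
  generalize ∫⁻ z, ENNReal.ofReal (k z) ∂F = Q at *
  generalize ∫⁻ z, ((k z : EReal) - f z).toENNReal ∂F = D at *
  have hP : P ≠ ⊤ := ne_top_of_le_ne_top hint hpos
  lift P to ℝ≥0 using hP
  lift Q to ℝ≥0 using hint
  by_cases hN : N = ⊤
  · have hD : D = ⊤ := by
      simpa [hN] using hsum
    simp [hN, hD]
  · have hD : D ≠ ⊤ := by
      rintro rfl
      have hQN : (Q : ℝ≥0∞) + N = ⊤ := by simpa using hsum.symm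
      exact hN (by simpa using hQN)
    lift N to ℝ≥0 using hN
    lift D to ℝ≥0 using hD
    have h1 : (P : ℝ) + D = Q + N := by exact_mod_cast hsum
    have h2 : (P : ℝ) - N = Q - D := by linarith
    simp only [ENNReal.coe_toReal, EReal.coe_nnreal_eq_coe_real]
    exact_mod_cast h2

section Geometry

variable {d : ℕ}

lemma abs_dotp_le (y z : EuclideanSpace ℝ (Fin d)) : |dotp y z| ≤ ‖y‖ * ‖z‖ := by
  have h : dotp y z = inner ℝ z y := by
    simp [dotp, PiLp.inner_apply]
  rw [h, mul_comm]
  exact abs_real_inner_le_norm z y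

lemma continuous_dotp_left (z : EuclideanSpace ℝ (Fin d)) : Continuous fun y => dotp y z := by
  unfold dotp
  fun_prop

lemma continuous_dotp_right (y : EuclideanSpace ℝ (Fin d)) : Continuous fun z => dotp y z := by
  unfold dotp
  fun_prop

lemma continuous_quadf (c : Matrix (Fin d) (Fin d) ℝ) : Continuous (quadf c) := by
  unfold quadf
  fun_prop

lemma dotp_add_smul (s t : ℝ) (y₀ y₁ z : EuclideanSpace ℝ (Fin d)) :
    dotp (s • y₀ + t • y₁) z = s * dotp y₀ z + t * dotp y₁ z := by
  simp only [dotp, PiLp.add_apply, PiLp.smul_apply, smul_eq_mul, Finset.mul_sum,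
    ← Finset.sum_add_distrib]
  exact Finset.sum_congr rfl fun i _ => by ring

lemma quadf_nonneg {c : Matrix (Fin d) (Fin d) ℝ} (hc : c.PosSemidef)
    (y : EuclideanSpace ℝ (Fin d)) : 0 ≤ quadf c y := by
  have h := hc.dotProduct_mulVec_nonneg (fun i => y i)
  simp only [dotProduct, Matrix.mulVec, Pi.star_apply, star_trivial, Finset.mul_sum] at h
  refine h.trans_eq ?_
  exact Finset.sum_congr rfl fun i _ => Finset.sum_congr rfl fun j _ => by ring

lemma quadf_convex {c : Matrix (Fin d) (Fin d) ℝ} (hc : c.PosSemidef)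
    (y₀ y₁ : EuclideanSpace ℝ (Fin d)) {t : ℝ} (ht : 0 ≤ t) (ht1 : t ≤ 1) :
    quadf c (t • y₀ + (1 - t) • y₁) ≤ t * quadf c y₀ + (1 - t) * quadf c y₁ := by
  have h : t * quadf c y₀ + (1 - t) * quadf c y₁ - quadf c (t • y₀ + (1 - t) • y₁) =
      t * (1 - t) * quadf c (y₀ - y₁) := by
    simp only [quadf, PiLp.add_apply, PiLp.sub_apply, PiLp.smul_apply, smul_eq_mul,
      Finset.mul_sum, ← Finset.sum_add_distrib, ← Finset.sum_sub_distrib]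
    exact Finset.sum_congr rfl fun i _ => Finset.sum_congr rfl fun j _ => by ring
  have := mul_nonneg (mul_nonneg ht (sub_nonneg.mpr ht1)) (quadf_nonneg hc (y₀ - y₁))
  linarith

lemma measurable_Kintegrand (p ε : ℝ) :
    Measurable (Kintegrand p ε : EuclideanSpace ℝ (Fin d) → ℝ) := by
  unfold Kintegrand
  split_ifs <;> fun_prop

lemma Kintegrand_nonneg (p ε : ℝ) (z : EuclideanSpace ℝ (Fin d)) : 0 ≤ Kintegrand p ε z := by
  have := Real.log_nonneg (x := 1 + ‖z‖) (by linarith [norm_nonneg z])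
  unfold Kintegrand
  split_ifs <;> positivity

variable {p ε : ℝ} {h : EuclideanSpace ℝ (Fin d) → EuclideanSpace ℝ (Fin d)}

lemma Ifun_eq (y z : EuclideanSpace ℝ (Fin d)) :
    Ifun p h y z = psi p (1 + dotp y z) - (dotp y (h z) : ℝ) := by
  unfold Ifun psi phi
  by_cases h1 : 0 < 1 + dotp y z
  · by_cases h2 : p = 0 <;> simp [h1, h2]
  · by_cases h2 : 0 < p
    · simp [h1, h2, h2.not_ge, h2.ne']
    · simp [h1, h2, not_lt.mp h2]

lemma measurable_Ifun (hh : Measurable h) (y : EuclideanSpace ℝ (Fin d)) :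
    Measurable fun z => Ifun p h y z := by
  simp only [Ifun_eq]
  have h1 : Measurable fun z => psi p (1 + dotp y z) :=
    (measurable_psi p).comp (measurable_const.add (continuous_dotp_right y).measurable)
  have h2 : Measurable fun z => ((dotp y (h z) : ℝ) : EReal) :=
    ((continuous_dotp_right y).measurable.comp hh).coe_real_ereal
  exact h1.sub h2

lemma continuousOn_Ifun (z : EuclideanSpace ℝ (Fin d)) :
    ContinuousOn (fun y => Ifun p h y z) {y | -1 ≤ dotp y z} := by
  intro y hy
  simp only [Ifun_eq]
  have h1 : ContinuousWithinAt (fun y => psi p (1 + dotp y z)) {y | -1 ≤ dotp y z} y := by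
    have hc : Continuous fun y => 1 + dotp y z := continuous_const.add (continuous_dotp_left z)
    refine ((continuousOn_psi p).comp hc.continuousOn ?_) y hy
    intro w hw
    have : -1 ≤ dotp w z := hw
    simp only [mem_Ici]
    linarith
  have h2 : ContinuousWithinAt (fun y => ((-dotp y (h z) : ℝ) : EReal)) {y | -1 ≤ dotp y z} y :=
    (continuous_coe_real_ereal.comp (continuous_dotp_left (h z)).neg).continuousWithinAt
  have h3 := EReal.continuousAt_add (p := (psi p (1 + dotp y z), ((-dotp y (h z) : ℝ) : EReal)))
    (by simp) (by simp)
  refine (h3.comp_continuousWithinAt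
    (f := fun y => (psi p (1 + dotp y z), ((-dotp y (h z) : ℝ) : EReal)))
    (h1.prodMk h2)).congr (fun w _ => ?_) ?_ <;>
  simp [sub_eq_add_neg]

lemma exists_Ifun_le (hp : p = 0 ∨ p < 0 ∨ (0 < p ∧ p < 1)) (hε : 0 < ε) (hh : IsTruncation h)
    {R : ℝ} (hR : 0 ≤ R) :
    ∃ A : ℝ, 0 ≤ A ∧ ∀ y : EuclideanSpace ℝ (Fin d), ‖y‖ ≤ R → ∀ z, -1 ≤ dotp y z →
      Ifun p h y z ≤ ((A * Kintegrand p ε z : ℝ) : EReal) := by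
  obtain ⟨M, hM⟩ := hh.bounded
  obtain ⟨δ, hδ, hid⟩ := hh.eq_id_near_zero
  have hM0 : 0 ≤ M := (norm_nonneg _).trans (hM 0)
  have hp1 : p < 1 := by
    rcases hp with h | h | h <;> linarith
  obtain ⟨A, hA, hbd⟩ := exists_phi_tail_bound hp hε hδ hR (mul_nonneg hR hM0)
  refine ⟨A, hA, fun y hy z hyz => ?_⟩
  rw [Ifun_eq, psi]
  split_ifs with hpos
  · rw [← EReal.coe_sub, EReal.coe_le_coe_iff]
    have h0 : 0 ≤ 1 + dotp y z := by linarith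
    rcases lt_or_ge ‖z‖ δ with hz | hz
    · have h1 := phi_le_sub_one hp1 h0 hpos
      have h2 := mul_nonneg hA (Kintegrand_nonneg p ε z)
      rw [hid z hz]
      linarith
    · have h1 : dotp y z ≤ R * ‖z‖ :=
        (le_abs_self _).trans ((abs_dotp_le y z).trans (by gcongr))
      have h2 : -dotp y (h z) ≤ R * M :=
        (neg_le_abs _).trans ((abs_dotp_le y (h z)).trans (by gcongr; exact hM z))
      have h3 := phi_mono h0 hpos (show 1 + dotp y z ≤ 1 + R * ‖z‖ by linarith)
      have h4 := hbd z hz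
      linarith
  · simp

/-- The gap between the dominating function `A * Kintegrand p ε` and `Ifun p h y`. -/
def deficit (p ε : ℝ) (h : EuclideanSpace ℝ (Fin d) → EuclideanSpace ℝ (Fin d)) (A : ℝ)
    (y z : EuclideanSpace ℝ (Fin d)) : ℝ≥0∞ :=
  (((A * Kintegrand p ε z : ℝ) : EReal) - Ifun p h y z).toENNReal

lemma measurable_deficit (hh : Measurable h) (A : ℝ) (y : EuclideanSpace ℝ (Fin d)) :
    Measurable (deficit p ε h A y) := by
  have h1 : Measurable fun z : EuclideanSpace ℝ (Fin d) =>
      ((A * Kintegrand p ε z : ℝ) : EReal) :=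
    ((measurable_Kintegrand p ε).const_mul A).coe_real_ereal
  exact (h1.sub (measurable_Ifun hh y)).ereal_toENNReal

lemma continuousOn_deficit (A : ℝ) (z : EuclideanSpace ℝ (Fin d)) :
    ContinuousOn (fun y => deficit p ε h A y z) {y | -1 ≤ dotp y z} := by
  have hc : ∀ a : ℝ, Continuous fun x : EReal => (a : EReal) - x := fun a => by
    rw [continuous_iff_continuousAt]
    intro x
    have h3 := EReal.continuousAt_add (p := ((a : EReal), -x)) (by simp) (by simp)
    simpa only [sub_eq_add_neg, Function.comp_def] using
      h3.comp (f := fun x : EReal => ((a : EReal), -x))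
        (continuousAt_const.prodMk continuous_neg.continuousAt)
  exact (((hc _).comp_continuousOn (continuousOn_Ifun z))).ereal_toENNReal

lemma deficit_convex (hp : p < 1) (A : ℝ) {y₀ y₁ z : EuclideanSpace ℝ (Fin d)}
    (hy₀ : -1 ≤ dotp y₀ z) (hy₁ : -1 ≤ dotp y₁ z) {t : ℝ} (ht : 0 < t) (ht1 : t < 1) :
    deficit p ε h A (t • y₀ + (1 - t) • y₁) z ≤
      ENNReal.ofReal t * deficit p ε h A y₀ z + ENNReal.ofReal (1 - t) * deficit p ε h A y₁ z := by
  have ht' : 0 < 1 - t := by linarith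
  have htop : ∀ y : EuclideanSpace ℝ (Fin d), ¬(0 < 1 + dotp y z ∨ 0 < p) →
      deficit p ε h A y z = ⊤ := by
    intro y hy
    rw [deficit, Ifun_eq, psi, if_neg hy, EReal.bot_sub, EReal.coe_sub_bot, EReal.toENNReal_top]
  have hreal : ∀ y : EuclideanSpace ℝ (Fin d), (0 < 1 + dotp y z ∨ 0 < p) →
      deficit p ε h A y z = ENNReal.ofReal
        (A * Kintegrand p ε z - (phi p (1 + dotp y z) - dotp y (h z))) := by
    intro y hy
    rw [deficit, Ifun_eq, psi, if_pos hy, ← EReal.coe_sub, ← EReal.coe_sub,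
      EReal.real_coe_toENNReal]
  by_cases h0 : 0 < 1 + dotp y₀ z ∨ 0 < p
  swap
  · rw [htop y₀ h0, ENNReal.mul_top (by simpa using ht)]
    simp
  by_cases h1 : 0 < 1 + dotp y₁ z ∨ 0 < p
  swap
  · rw [htop y₁ h1, ENNReal.mul_top (by simpa using ht1)]
    simp
  have hcomb : 1 + dotp (t • y₀ + (1 - t) • y₁) z =
      t * (1 + dotp y₀ z) + (1 - t) * (1 + dotp y₁ z) := by
    rw [dotp_add_smul]
    ring
  have h2 : 0 < 1 + dotp (t • y₀ + (1 - t) • y₁) z ∨ 0 < p := by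
    by_cases hp0 : 0 < p
    · exact Or.inr hp0
    · have h0' := h0.resolve_right hp0
      have h1' := h1.resolve_right hp0
      rw [hcomb]
      exact Or.inl (by positivity)
  rw [hreal _ h0, hreal _ h1, hreal _ h2, ← ENNReal.ofReal_mul ht.le, ← ENNReal.ofReal_mul ht'.le]
  refine le_trans (ENNReal.ofReal_le_ofReal ?_) ENNReal.ofReal_add_le
  have h3 := phi_concave hp (by linarith) h0 (by linarith) h1 ht.le ht'.le (by ring)
  rw [hcomb, dotp_add_smul]
  linarith

lemma gTheta_eq {θ : Triple d} (hh : Measurable h) {A : ℝ} (hA : 0 ≤ A)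
    (hK : ∫⁻ z, ENNReal.ofReal (Kintegrand p ε z) ∂θ.2.2 ≠ ⊤) {y : EuclideanSpace ℝ (Fin d)}
    (hy : ∀ᵐ z ∂θ.2.2, -1 ≤ dotp y z)
    (hle : ∀ z, -1 ≤ dotp y z → Ifun p h y z ≤ ((A * Kintegrand p ε z : ℝ) : EReal)) :
    gTheta p h θ y =
      ((dotp y θ.1 + (p - 1) / 2 * quadf θ.2.1 y +
        (∫⁻ z, ENNReal.ofReal (A * Kintegrand p ε z) ∂θ.2.2).toReal : ℝ) : EReal) -
      ((∫⁻ z, deficit p ε h A y z ∂θ.2.2 : ℝ≥0∞) : EReal) := by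
  have hint : ∫⁻ z, ENNReal.ofReal (A * Kintegrand p ε z) ∂θ.2.2 ≠ ⊤ := by
    simp only [ENNReal.ofReal_mul hA]
    rw [lintegral_const_mul _ (measurable_Kintegrand p ε).ennreal_ofReal]
    exact ENNReal.mul_ne_top ENNReal.ofReal_ne_top hK
  rw [gTheta, gfun, eIntegral_eq_of_le (measurable_Ifun hh y)
    ((measurable_Kintegrand p ε).const_mul A) (fun z => mul_nonneg hA (Kintegrand_nonneg p ε z))
    (hy.mono hle) hint, EReal.coe_add _ (ENNReal.toReal _), ← add_sub_assoc]
  rfl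

lemma ae_of_mem_natC {Θ : Set (Triple d)} {θ : Triple d} (hθ : θ ∈ Θ)
    {y : EuclideanSpace ℝ (Fin d)} (hy : y ∈ natC Θ) : ∀ᵐ z ∂θ.2.2, -1 ≤ dotp y z := by
  rw [ae_iff]
  simpa only [not_le] using hy θ hθ

lemma limsup_coe_sub_le {a : ℕ → ℝ} {b : ℝ} {x : ℕ → ℝ≥0∞} {w : ℝ≥0∞}
    (ha : Tendsto a atTop (𝓝 b)) (hw : w ≤ liminf x atTop) :
    limsup (fun n => (a n : EReal) - (x n : EReal)) atTop ≤ (b : EReal) - w := by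
  have h1 : limsup (fun n => (a n : EReal)) atTop = b := (EReal.tendsto_coe.mpr ha).limsup_eq
  have hmono : Monotone ((↑) : ℝ≥0∞ → EReal) := fun _ _ => EReal.coe_ennreal_le_coe_ennreal_iff.mpr
  have h2 : (w : EReal) ≤ liminf (fun n => (x n : EReal)) atTop := by
    have := hmono.map_liminf_of_continuousAt (F := atTop) x continuous_coe_ennreal_ereal.continuousAt
    exact (hmono hw).trans_eq this
  have h3 := EReal.limsup_add_le (f := atTop) (u := fun n => (a n : EReal))
    (v := -fun n => (x n : EReal)) (by simp [h1]) (by simp [h1])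
  rw [h1, EReal.limsup_neg] at h3
  simp only [sub_eq_add_neg]
  exact h3.trans (add_le_add_right (EReal.neg_le_neg_iff.mpr h2) _)

lemma coe_sub_concave {a b c t : ℝ} {u v w : ℝ≥0∞} (ht : 0 < t) (ht1 : t < 1)
    (hc : t * a + (1 - t) * b ≤ c)
    (hw : w ≤ ENNReal.ofReal t * u + ENNReal.ofReal (1 - t) * v) :
    (t : EReal) * ((a : EReal) - u) + ((1 - t : ℝ) : EReal) * ((b : EReal) - v) ≤
      (c : EReal) - w := by
  by_cases hu : u = ⊤
  · simp [hu, EReal.coe_mul_bot_of_pos ht]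
  by_cases hv : v = ⊤
  · simp only [hv, EReal.coe_ennreal_top, EReal.sub_top, EReal.coe_mul_bot_of_pos (sub_pos.mpr ht1)]
    simp
  have hwt : w ≠ ⊤ := ne_top_of_le_ne_top (by finiteness) hw
  lift u to ℝ≥0 using hu
  lift v to ℝ≥0 using hv
  lift w to ℝ≥0 using hwt
  have hw' : (w : ℝ) ≤ t * u + (1 - t) * v := by
    have := ENNReal.toReal_mono (by finiteness) hw
    rwa [ENNReal.toReal_add (by finiteness) (by finiteness), ENNReal.toReal_mul,
      ENNReal.toReal_mul, ENNReal.toReal_ofReal ht.le,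
      ENNReal.toReal_ofReal (sub_pos.mpr ht1).le] at this
  have : t * (a - u) + (1 - t) * (b - v) ≤ c - w := by linarith
  simp only [EReal.coe_nnreal_eq_coe_real]
  exact_mod_cast this

end Geometry

namespace Standing

variable {d : ℕ} {p ε : ℝ} {h : EuclideanSpace ℝ (Fin d) → EuclideanSpace ℝ (Fin d)}
  {Θ : Set (Triple d)} {C : Set (EuclideanSpace ℝ (Fin d))} {θ : Triple d}

lemma lt_one (SA : Standing p ε h Θ C) : p < 1 := by
  rcases SA.p_range with h | h | h <;> linarith

lemma lintegral_Kintegrand_ne_top (SA : Standing p ε h Θ C) (hθ : θ ∈ Θ) :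
    ∫⁻ z, ENNReal.ofReal (Kintegrand p ε z) ∂θ.2.2 ≠ ⊤ := by
  obtain ⟨K, hK⟩ := SA.K_finite
  exact (hK θ hθ).1

lemma exists_gTheta_eq (SA : Standing p ε h Θ C) (hθ : θ ∈ Θ) {R : ℝ} (hR : 0 ≤ R) :
    ∃ A B : ℝ, ∀ y ∈ natC Θ, ‖y‖ ≤ R → gTheta p h θ y =
      ((dotp y θ.1 + (p - 1) / 2 * quadf θ.2.1 y + B : ℝ) : EReal) -
        ((∫⁻ z, deficit p ε h A y z ∂θ.2.2 : ℝ≥0∞) : EReal) := by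
  obtain ⟨A, hA, hle⟩ := exists_Ifun_le SA.p_range SA.eps_pos SA.trunc hR
  exact ⟨A, _, fun y hy hyR => gTheta_eq SA.trunc.measurable hA
    (SA.lintegral_Kintegrand_ne_top hθ) (ae_of_mem_natC hθ hy) (hle y hyR)⟩

lemma gTheta_lt_top (SA : Standing p ε h Θ C) (hθ : θ ∈ Θ) {y : EuclideanSpace ℝ (Fin d)}
    (hy : y ∈ natC Θ) : gTheta p h θ y < ⊤ := by
  obtain ⟨A, B, hAB⟩ := SA.exists_gTheta_eq hθ (norm_nonneg y)
  rw [hAB y hy le_rfl, sub_eq_add_neg]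
  exact EReal.add_lt_top (EReal.coe_ne_top _) (by simp)

lemma gTheta_concave (SA : Standing p ε h Θ C) (hθ : θ ∈ Θ) {y₀ y₁ : EuclideanSpace ℝ (Fin d)}
    (hy₀ : y₀ ∈ natC Θ) (hy₁ : y₁ ∈ natC Θ) {t : ℝ} (ht : 0 < t) (ht1 : t < 1) :
    (t : EReal) * gTheta p h θ y₀ + ((1 - t : ℝ) : EReal) * gTheta p h θ y₁ ≤
      gTheta p h θ (t • y₀ + (1 - t) • y₁) := by
  have ht' : 0 < 1 - t := sub_pos.mpr ht1
  have hmem : t • y₀ + (1 - t) • y₁ ∈ natC Θ := by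
    intro θ' hθ'
    have : ∀ᵐ z ∂θ'.2.2, -1 ≤ dotp (t • y₀ + (1 - t) • y₁) z := by
      filter_upwards [ae_of_mem_natC hθ' hy₀, ae_of_mem_natC hθ' hy₁] with z h0 h1
      rw [dotp_add_smul]
      nlinarith
    simpa only [ae_iff, not_le] using this
  obtain ⟨A, B, hAB⟩ := SA.exists_gTheta_eq hθ (R := max ‖y₀‖ ‖y₁‖) (by positivity)
  have hnorm : ‖t • y₀ + (1 - t) • y₁‖ ≤ max ‖y₀‖ ‖y₁‖ := by
    refine (norm_add_le _ _).trans ?_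
    rw [norm_smul, norm_smul, Real.norm_of_nonneg ht.le, Real.norm_of_nonneg ht'.le]
    nlinarith [le_max_left ‖y₀‖ ‖y₁‖, le_max_right ‖y₀‖ ‖y₁‖]
  rw [hAB _ hy₀ (le_max_left _ _), hAB _ hy₁ (le_max_right _ _), hAB _ hmem hnorm]
  refine coe_sub_concave ht ht1 ?_ ?_
  · have h1 := quadf_convex (SA.Theta_psd θ hθ) y₀ y₁ ht.le ht1.le
    have h2 : (p - 1) / 2 ≤ 0 := by linarith [SA.lt_one]
    have h3 := mul_le_mul_of_nonpos_left h1 h2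
    rw [dotp_add_smul]
    linarith
  · have hm := fun y => measurable_deficit (p := p) (ε := ε) SA.trunc.measurable A y
    rw [← lintegral_const_mul _ (hm y₀), ← lintegral_const_mul _ (hm y₁),
      ← lintegral_add_left ((hm y₀).const_mul _)]
    refine lintegral_mono_ae ?_
    filter_upwards [ae_of_mem_natC hθ hy₀, ae_of_mem_natC hθ hy₁] with z h0 h1
    exact deficit_convex SA.lt_one A h0 h1 ht ht1

lemma limsup_gTheta_le (SA : Standing p ε h Θ C) (hθ : θ ∈ Θ)
    {yseq : ℕ → EuclideanSpace ℝ (Fin d)} {y : EuclideanSpace ℝ (Fin d)}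
    (hseq : ∀ n, yseq n ∈ natC Θ) (hy : y ∈ natC Θ) (hlim : Tendsto yseq atTop (𝓝 y)) :
    limsup (fun n => gTheta p h θ (yseq n)) atTop ≤ gTheta p h θ y := by
  obtain ⟨R, hR⟩ := hlim.norm.bddAbove_range
  have hRn : ∀ n, ‖yseq n‖ ≤ R := fun n => hR (mem_range_self n)
  obtain ⟨A, B, hAB⟩ := SA.exists_gTheta_eq hθ ((norm_nonneg _).trans (hRn 0))
  rw [hAB y hy (le_of_tendsto' hlim.norm hRn)]
  simp only [fun n => hAB _ (hseq n) (hRn n)]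
  refine limsup_coe_sub_le ?_ ?_
  · have hc : Continuous fun y => dotp y θ.1 + (p - 1) / 2 * quadf θ.2.1 y + B :=
      ((continuous_dotp_left _).add (continuous_const.mul (continuous_quadf _))).add
        continuous_const
    exact (hc.tendsto y).comp hlim
  · refine le_trans (lintegral_mono_ae ?_)
      (lintegral_liminf_le fun n => measurable_deficit SA.trunc.measurable A (yseq n))
    filter_upwards [ae_of_mem_natC hθ hy,
      ae_all_iff.mpr fun n => ae_of_mem_natC hθ (hseq n)] with z hz hzn
    have hw : Tendsto yseq atTop (𝓝[{y | -1 ≤ dotp y z}] y) :=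
      tendsto_nhdsWithin_iff.mpr ⟨hlim, Eventually.of_forall hzn⟩
    exact ((continuousOn_deficit A z y hz).tendsto.comp hw).liminf_eq.ge

lemma limsup_iInf_gTheta_le (SA : Standing p ε h Θ C)
    {yseq : ℕ → EuclideanSpace ℝ (Fin d)} {y : EuclideanSpace ℝ (Fin d)}
    (hseq : ∀ n, yseq n ∈ natC Θ) (hy : y ∈ natC Θ) (hlim : Tendsto yseq atTop (𝓝 y)) :
    limsup (fun n => ⨅ θ ∈ Θ, gTheta p h θ (yseq n)) atTop ≤ ⨅ θ ∈ Θ, gTheta p h θ y :=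
  le_iInf₂ fun θ hθ => (limsup_le_limsup (Eventually.of_forall fun _ => iInf₂_le θ hθ)).trans
    (SA.limsup_gTheta_le hθ hseq hy hlim)

lemma exists_max (SA : Standing p ε h Θ C) {f : EuclideanSpace ℝ (Fin d) → EReal}
    (hf : ∀ (yseq : ℕ → EuclideanSpace ℝ (Fin d)) (y : EuclideanSpace ℝ (Fin d)),
      (∀ n, yseq n ∈ natC Θ) → y ∈ natC Θ → Tendsto yseq atTop (𝓝 y) →
      limsup (fun n => f (yseq n)) atTop ≤ f y) :
    ∃ yhat ∈ C ∩ natC Θ, ∀ y ∈ C ∩ natC Θ, f y ≤ f yhat := by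
  have hne : (C ∩ natC Θ).Nonempty := by
    refine ⟨0, SA.C_zero, fun θ _ => ?_⟩
    have : {z : EuclideanSpace ℝ (Fin d) | dotp 0 z < -1} = ∅ := by
      ext z
      simp [dotp]
    simp [this]
  have husc : UpperSemicontinuousOn f (C ∩ natC Θ) := by
    intro y hy c hc
    by_contra hcon
    rw [not_eventually] at hcon
    obtain ⟨yseq, hlim, hge⟩ := exists_seq_forall_of_frequently
      (hcon.and_eventually self_mem_nhdsWithin)
    have h1 := hf yseq y (fun n => (hge n).2.2) hy.2 (tendsto_nhds_of_tendsto_nhdsWithin hlim)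
    have h2 : c ≤ limsup (fun n => f (yseq n)) atTop :=
      le_limsup_of_frequently_le (Frequently.of_forall fun n => not_lt.mp (hge n).1)
    exact (hc.trans_le (h2.trans h1)).false
  obtain ⟨yhat, hmem, hmax⟩ := husc.exists_isMaxOn hne SA.CC0_compact
  exact ⟨yhat, hmem, fun y hy => hmax hy⟩

end Standing

/-- Under the standing assumptions, the function
`g(y) = inf_{θ ∈ Θ} g^θ(y)` is concave (in the extended sense) and upper semicontinuous
on `C⁰`, with values in `[-∞,∞)`, and both `g` and every individual `g^θ`, `θ ∈ Θ`,
attain their maximum over `C ∩ C⁰`. -/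
theorem stmt5 {d : ℕ} (hd : 1 ≤ d) (p ε : ℝ)
    (h : EuclideanSpace ℝ (Fin d) → EuclideanSpace ℝ (Fin d))
    (Θ : Set (Triple d)) (C : Set (EuclideanSpace ℝ (Fin d)))
    (SA : Standing p ε h Θ C) :
    -- values in [-∞, ∞) on C⁰
    (∀ y ∈ natC Θ, (⨅ θ ∈ Θ, gTheta p h θ y) < (⊤ : EReal)) ∧
    -- concavity in the extended sense on C⁰
    (∀ y₀ ∈ natC Θ, ∀ y₁ ∈ natC Θ, ∀ t : ℝ, 0 ≤ t → t ≤ 1 →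
      ((t : ℝ) : EReal) * (⨅ θ ∈ Θ, gTheta p h θ y₀) +
          (((1 - t : ℝ)) : EReal) * (⨅ θ ∈ Θ, gTheta p h θ y₁) ≤
        ⨅ θ ∈ Θ, gTheta p h θ (t • y₀ + (1 - t) • y₁)) ∧
    -- upper semicontinuity on C⁰ (sequential)
    (∀ (yseq : ℕ → EuclideanSpace ℝ (Fin d)) (y : EuclideanSpace ℝ (Fin d)),
      (∀ n, yseq n ∈ natC Θ) → y ∈ natC Θ → Tendsto yseq atTop (nhds y) →
      Filter.limsup (fun n => ⨅ θ ∈ Θ, gTheta p h θ (yseq n)) atTop ≤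
        ⨅ θ ∈ Θ, gTheta p h θ y) ∧
    -- g attains its maximum over C ∩ C⁰
    (∃ yhat ∈ C ∩ natC Θ, ∀ y ∈ C ∩ natC Θ,
      (⨅ θ ∈ Θ, gTheta p h θ y) ≤ ⨅ θ ∈ Θ, gTheta p h θ yhat) ∧
    -- every g^θ attains its maximum over C ∩ C⁰
    (∀ θ ∈ Θ, ∃ yhat ∈ C ∩ natC Θ, ∀ y ∈ C ∩ natC Θ,
      gTheta p h θ y ≤ gTheta p h θ yhat) := by
  refine ⟨?_, ?_, ?_, ?_, ?_⟩
  · intro y hy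
    obtain ⟨θ, hθ⟩ := SA.Theta_nonempty
    exact (iInf₂_le θ hθ).trans_lt (SA.gTheta_lt_top hθ hy)
  · intro y₀ hy₀ y₁ hy₁ t ht ht1
    rcases ht.eq_or_lt with rfl | ht
    · simp
    rcases ht1.eq_or_lt with rfl | ht1
    · simp
    refine le_iInf₂ fun θ hθ => le_trans ?_ (SA.gTheta_concave hθ hy₀ hy₁ ht ht1)
    have hle := fun y => iInf₂_le (f := fun θ (_ : θ ∈ Θ) => gTheta p h θ y) θ hθ
    exact add_le_add
      (mul_le_mul_of_nonneg_left (hle y₀) (EReal.coe_nonneg.mpr ht.le))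
      (mul_le_mul_of_nonneg_left (hle y₁) (EReal.coe_nonneg.mpr (sub_nonneg.mpr ht1.le)))
  · exact fun yseq y hseq hy hlim => SA.limsup_iInf_gTheta_le hseq hy hlim
  · exact SA.exists_max fun yseq y hseq hy hlim => SA.limsup_iInf_gTheta_le hseq hy hlim
  · exact fun θ hθ => SA.exists_max fun yseq y hseq hy hlim => SA.limsup_gTheta_le hθ hseq hy hlim
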